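/- For every positive integer n and every nonzero real number x, x^n · B̂_n^-(1/x) = B̂_n^+(x), where B̂_n^-(x) = ∑_{σ ∈ B_n, σ(1)<0} x^{d̂_B(σ)} and B̂_n^+(x) = ∑_{σ ∈ B_n, σ(1)>0} x^{d̂_B(σ)}. -/

import Mathlib

open Finset

/-- The word of a permutation of `{1,...,n}` with boundary convention `σ(0) = σ(n+1) = n+1`. -/
def extA (n : ℕ) (σ : Equiv.Perm (Fin n)) : ℕ → ℕ := fun i =>
  if h : 1 ≤ i ∧ i ≤ n then (σ ⟨i - 1, by omega⟩ : ℕ) + 1 else n + 1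

/-- The word of a permutation of `{1,...,n}` with boundary convention `σ(0) = 0`, `σ(n+1) = n+1`. -/
def ext0 (n : ℕ) (σ : Equiv.Perm (Fin n)) : ℕ → ℕ := fun i =>
  if h : 1 ≤ i ∧ i ≤ n then (σ ⟨i - 1, by omega⟩ : ℕ) + 1
  else if i = 0 then 0 else n + 1

/-- Number of double ascents (indices `i ∈ {1,...,n}` with `w(i-1) < w(i) < w(i+1)`). -/
def daCount (n : ℕ) (w : ℕ → ℕ) : ℕ :=
  ((Icc 1 n).filter fun i => w (i - 1) < w i ∧ w i < w (i + 1)).card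

/-- Number of double descents (indices `i ∈ {1,...,n}` with `w(i-1) > w(i) > w(i+1)`). -/
def ddCount (n : ℕ) (w : ℕ → ℕ) : ℕ :=
  ((Icc 1 n).filter fun i => w i < w (i - 1) ∧ w (i + 1) < w i).card

/-- Number of valleys (indices `i ∈ {1,...,n}` with `w(i-1) > w(i) < w(i+1)`). -/
def valCount (n : ℕ) (w : ℕ → ℕ) : ℕ :=
  ((Icc 1 n).filter fun i => w i < w (i - 1) ∧ w i < w (i + 1)).card

/-- Number of peaks (indices `i ∈ {1,...,n}` with `w(i-1) < w(i) > w(i+1)`). -/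
def pkCount (n : ℕ) (w : ℕ → ℕ) : ℕ :=
  ((Icc 1 n).filter fun i => w (i - 1) < w i ∧ w (i + 1) < w i).card

/-- `dda = da + dd`. -/
def ddaCount (n : ℕ) (w : ℕ → ℕ) : ℕ := daCount n w + ddCount n w

/-- Number of alternating descents of a permutation of `{1,...,n}`:
indices `i ∈ {1,...,n-1}` with `σ(i) > σ(i+1)` and `i` odd, or `σ(i) < σ(i+1)` and `i` even. -/
def altDesA (n : ℕ) (σ : Equiv.Perm (Fin n)) : ℕ :=
  ((Ico 1 n).filter fun i =>
    (Odd i ∧ extA n σ (i + 1) < extA n σ i) ∨ (Even i ∧ extA n σ i < extA n σ (i + 1))).card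

/-- The alternating Eulerian polynomial `Â_n(x)`. -/
noncomputable def hatA (n : ℕ) (x : ℝ) : ℝ := ∑ σ : Equiv.Perm (Fin n), x ^ altDesA n σ

/-- The signed word of a type B permutation encoded as a pair `(σ, ε)` of a permutation of
`{1,...,n}` and a sign vector; position `0` (and positions `> n`) carry the value `0`. -/
def wordB (n : ℕ) (σ : Equiv.Perm (Fin n)) (ε : Fin n → Bool) : ℕ → ℤ := fun i =>
  if h : 1 ≤ i ∧ i ≤ n then
    (if ε ⟨i - 1, by omega⟩ then ((σ ⟨i - 1, by omega⟩ : ℕ) + 1 : ℤ)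
     else -((σ ⟨i - 1, by omega⟩ : ℕ) + 1 : ℤ))
  else 0

/-- `i` is an alternating descent position of the word `w`:
either `i` is even and `w(i) < w(i+1)`, or `i` is odd and `w(i) > w(i+1)`. -/
def isAltDesZ (w : ℕ → ℤ) (i : ℕ) : Prop :=
  (Even i ∧ w i < w (i + 1)) ∨ (Odd i ∧ w (i + 1) < w i)

instance (w : ℕ → ℤ) : DecidablePred (isAltDesZ w) := fun i => by
  unfold isAltDesZ; infer_instance

/-- `d̂_B`: number of type B alternating descent positions `i ∈ {0,1,...,n-1}`. -/
def altDesB (n : ℕ) (σ : Equiv.Perm (Fin n)) (ε : Fin n → Bool) : ℕ :=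
  ((range n).filter (isAltDesZ (wordB n σ ε))).card

/-- The type B alternating Eulerian polynomial `B̂_n(x)`. -/
noncomputable def hatB (n : ℕ) (x : ℝ) : ℝ :=
  ∑ p : Equiv.Perm (Fin n) × (Fin n → Bool), x ^ altDesB n p.1 p.2

/-- `d̂`: number of alternating descent positions `i ∈ {1,...,n-1}` of a signed word
(position `0` excluded). -/
def altDesWord (n : ℕ) (w : ℕ → ℤ) : ℕ := ((Ico 1 n).filter (isAltDesZ w)).card

/-- Derivative polynomials of the tangent function: `P₀ = X`, `P_{n+1} = (1+X²)·Pₙ'`. -/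
noncomputable def tanP : ℕ → Polynomial ℝ
  | 0 => Polynomial.X
  | n + 1 => (1 + Polynomial.X ^ 2) * Polynomial.derivative (tanP n)

/-- Derivative polynomials of the secant function: `Q₀ = 1`, `Q_{n+1} = X·Qₙ + (1+X²)·Qₙ'`. -/
noncomputable def secQ : ℕ → Polynomial ℝ
  | 0 => 1
  | n + 1 => Polynomial.X * secQ n + (1 + Polynomial.X ^ 2) * Polynomial.derivative (secQ n)

/-- The word of `(σ, ε)` is down-up alternating: `π(1) > π(2) < π(3) > π(4) ⋯`. -/
def isDownUpB (m : ℕ) (σ : Equiv.Perm (Fin m)) (ε : Fin m → Bool) : Prop :=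
  ∀ i ∈ Ico 1 m,
    (Odd i → wordB m σ ε (i + 1) < wordB m σ ε i) ∧
    (Even i → wordB m σ ε i < wordB m σ ε (i + 1))

instance (m : ℕ) (σ : Equiv.Perm (Fin m)) (ε : Fin m → Bool) : Decidable (isDownUpB m σ ε) := by
  unfold isDownUpB; infer_instance

/-- `DU_m^{(B)}`: the number of down-up alternating type B permutations of length `m`. -/
def duBCount (m : ℕ) : ℕ :=
  (Finset.univ.filter fun p : Equiv.Perm (Fin m) × (Fin m → Bool) =>
    isDownUpB m p.1 p.2).card

/-- `S_m`: the number of snakes of length `m` (down-up alternating type B permutations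
whose first entry is positive). -/
def snakeCount (m : ℕ) : ℕ :=
  (Finset.univ.filter fun p : Equiv.Perm (Fin m) × (Fin m → Bool) =>
    0 < wordB m p.1 p.2 1 ∧ isDownUpB m p.1 p.2).card

/-- `B̂_n^-(x)`: sum over type B permutations with negative first entry. -/
noncomputable def hatBminus (n : ℕ) (x : ℝ) : ℝ :=
  ∑ p ∈ Finset.univ.filter
      (fun p : Equiv.Perm (Fin n) × (Fin n → Bool) => wordB n p.1 p.2 1 < 0),
    x ^ altDesB n p.1 p.2

/-- `B̂_n^+(x)`: sum over type B permutations with positive first entry. -/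
noncomputable def hatBplus (n : ℕ) (x : ℝ) : ℝ :=
  ∑ p ∈ Finset.univ.filter
      (fun p : Equiv.Perm (Fin n) × (Fin n → Bool) => 0 < wordB n p.1 p.2 1),
    x ^ altDesB n p.1 p.2

lemma wordB_not (n : ℕ) (σ : Equiv.Perm (Fin n)) (ε : Fin n → Bool) (i : ℕ) :
    wordB n σ (fun j => !ε j) i = -wordB n σ ε i := by
  unfold wordB
  by_cases h : 1 ≤ i ∧ i ≤ n
  · cases hε : ε ⟨i - 1, by omega⟩ <;> simp [h, hε]
  · simp [h]

lemma wordB_natAbs (n : ℕ) (σ : Equiv.Perm (Fin n)) (ε : Fin n → Bool) {i : ℕ}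
    (h : 1 ≤ i ∧ i ≤ n) :
    (wordB n σ ε i).natAbs = (σ ⟨i - 1, by omega⟩ : ℕ) + 1 := by
  unfold wordB
  rw [dif_pos h]
  split_ifs <;> omega

lemma wordB_ne_succ (n : ℕ) (σ : Equiv.Perm (Fin n)) (ε : Fin n → Bool) {i : ℕ} (hi : i < n) :
    wordB n σ ε i ≠ wordB n σ ε (i + 1) := by
  intro heq
  have hs := wordB_natAbs n σ ε (i := i + 1) ⟨by omega, hi⟩
  rcases Nat.eq_zero_or_pos i with rfl | hpos
  · rw [← heq] at hs
    simp [wordB] at hs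
  · rw [← heq, wordB_natAbs n σ ε ⟨hpos, hi.le⟩] at hs
    have hσ := congrArg Fin.val (σ.injective (Fin.ext (Nat.succ_injective hs)))
    simp only at hσ
    omega

lemma isAltDesZ_wordB_not (n : ℕ) (σ : Equiv.Perm (Fin n)) (ε : Fin n → Bool) {i : ℕ}
    (hi : i < n) :
    isAltDesZ (wordB n σ (fun j => !ε j)) i ↔ ¬ isAltDesZ (wordB n σ ε) i := by
  have hne := wordB_ne_succ n σ ε hi
  unfold isAltDesZ
  rw [wordB_not, wordB_not]
  rcases Nat.even_or_odd i with h | h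
  · have h' := Nat.not_odd_iff_even.mpr h
    simp only [h, h', true_and, false_and, or_false]
    omega
  · have h' := Nat.not_even_iff_odd.mpr h
    simp only [h, h', true_and, false_and, false_or]
    omega

lemma altDesB_add_altDesB_not (n : ℕ) (σ : Equiv.Perm (Fin n)) (ε : Fin n → Bool) :
    altDesB n σ ε + altDesB n σ (fun j => !ε j) = n := by
  unfold altDesB
  rw [Finset.filter_congr (fun i hi => isAltDesZ_wordB_not n σ ε (Finset.mem_range.mp hi)),
    Finset.card_filter_add_card_filter_not, Finset.card_range]

/-- For every positive integer `n` and nonzero real `x`,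
`xⁿ · B̂_n⁻(1/x) = B̂_n⁺(x)`. -/
theorem stmt17 (n : ℕ) (hn : 0 < n) (x : ℝ) (hx : x ≠ 0) :
    x ^ n * hatBminus n (1 / x) = hatBplus n x := by
  unfold hatBminus hatBplus
  rw [Finset.mul_sum]
  refine Finset.sum_nbij' (fun p => (p.1, fun j => !p.2 j)) (fun p => (p.1, fun j => !p.2 j))
    ?_ ?_ ?_ ?_ ?_
  · simp [wordB_not]
  · simp [wordB_not]
  · simp
  · simp
  · rintro ⟨σ, ε⟩ -
    have h := altDesB_add_altDesB_not n σ ε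
    calc x ^ n * (1 / x) ^ altDesB n σ ε
        = x ^ (altDesB n σ ε + altDesB n σ (fun j => !ε j)) * (1 / x) ^ altDesB n σ ε := by
          rw [h]
      _ = x ^ altDesB n σ (fun j => !ε j) := by
          rw [pow_add, one_div, inv_pow]
          field_simp
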